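/- Let G be any d-regular finite simple graph on 2n vertices that contains at least one perfect matching. Form G_ω by listing the edges of G in a uniformly random order and taking the shortest initial segment in which every vertex has degree at least 1. Then the expected fraction of the perfect matchings of G that are contained in G_ω equals 2/binom(n+d−1, n) − 1/binom(n+2d−2, n). -/

import Mathlib

open Finset

/-- The degree of a vertex `v` in the graph whose edge set is the finite set `s`
of edges (elements of `Sym2 V`). -/
def degIn {V : Type*} [DecidableEq V] (s : Finset (Sym2 V)) (v : V) : ℕ :=
  (s.filter (fun e => v ∈ e)).card

/-- Given an ordering `ω` of a finite set `s` of edges, the set consisting of the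
first `i` edges `e_{ω(1)}, …, e_{ω(i)}`. -/
def prefixEdges {V : Type*} [DecidableEq V] {s : Finset (Sym2 V)}
    (ω : Fin s.card ≃ {e : Sym2 V // e ∈ s}) (i : ℕ) : Finset (Sym2 V) :=
  (Finset.univ.filter (fun j : Fin s.card => (j : ℕ) < i)).image (fun j => (ω j : Sym2 V))

/-- `k(ω)`: the least `i` such that every vertex has degree at least `δ` in the graph
formed by the first `i` edges of the ordering `ω`. -/
noncomputable def stopIndex {V : Type*} [Fintype V] [DecidableEq V] (δ : ℕ)
    {s : Finset (Sym2 V)} (ω : Fin s.card ≃ {e : Sym2 V // e ∈ s}) : ℕ :=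
  sInf {i | ∀ v : V, δ ≤ degIn (prefixEdges ω i) v}

/-- The edge set of `G_ω`, i.e. the first `k(ω)` edges of the ordering `ω`. -/
noncomputable def finalEdges {V : Type*} [Fintype V] [DecidableEq V] (δ : ℕ)
    {s : Finset (Sym2 V)} (ω : Fin s.card ≃ {e : Sym2 V // e ∈ s}) : Finset (Sym2 V) :=
  prefixEdges ω (stopIndex δ ω)

/-- A graph is `δ`-regular: every vertex has exactly `δ` neighbours. -/
def regOfDegree {V : Type*} (J : SimpleGraph V) (δ : ℕ) : Prop :=
  ∀ v : V, (J.neighborSet v).ncard = δ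

def goodOrd {α : Type*} {m : ℕ} (ω : Fin m ≃ α) (e : α) (A B : Finset α) : Prop :=
  (∀ x ∈ A, ω.symm x < ω.symm e) ∧ ∀ y ∈ B, ω.symm e < ω.symm y

open Classical in
lemma exists_inj_on {α : Type*} (A A' : Finset α) (h : A.card = A'.card) :
    ∃ f : α → α, (∀ x ∈ A, f x ∈ A') ∧ ∀ x ∈ A, ∀ y ∈ A, f x = f y → x = y := by
  let g := Finset.equivOfCardEq h
  refine ⟨fun x => if hx : x ∈ A then (g ⟨x, hx⟩ : α) else x, ?_, ?_⟩
  · intro x hx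
    simp [hx]
  · intro x hx y hy hxy
    simp only [hx, hy, dif_pos] at hxy
    have := g.injective (Subtype.ext hxy)
    simpa using this

open Classical in
lemma exists_perm {α : Type*} [Fintype α] (e e' : α) (A B A' B' : Finset α)
    (h1 : e ∉ A) (h2 : e ∉ B) (h3 : Disjoint A B)
    (h1' : e' ∉ A') (h2' : e' ∉ B') (h3' : Disjoint A' B')
    (hA : A.card = A'.card) (hB : B.card = B'.card) :
    ∃ σ : Equiv.Perm α, σ e = e' ∧ (∀ x ∈ A, σ x ∈ A') ∧ (∀ x ∈ B, σ x ∈ B') := by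
  obtain ⟨f, hf, hfi⟩ := exists_inj_on A A' hA
  obtain ⟨g, hg, hgi⟩ := exists_inj_on B B' hB
  rw [Finset.disjoint_left] at h3 h3'
  let F : α → α := fun x => if x ∈ A then f x else if x ∈ B then g x else e'
  have hFA : ∀ x ∈ A, F x = f x := fun x hx => by simp [F, hx]
  have hFB : ∀ x ∈ B, F x = g x := fun x hx => by
    have : x ∉ A := fun h => h3 h hx
    simp [F, hx, this]
  have hFe : F e = e' := by simp [F, h1, h2]
  obtain ⟨σ, hσ⟩ := Finset.exists_equiv_extend_of_card_eq (α := α) (β := α) (t := Finset.univ)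
    (by simp) (s := insert e (A ∪ B)) (f := F) (by simp) (by
      intro x hx y hy hxy
      simp only [Finset.coe_insert, Finset.coe_union, Set.mem_insert_iff, Set.mem_union, Finset.mem_coe] at hx hy
      rcases hx with rfl | hx | hx <;> rcases hy with rfl | hy | hy <;> grind)
  refine ⟨σ.trans (Equiv.subtypeUnivEquiv (by simp)), ?_, ?_, ?_⟩
  · simp [hσ e, hFe]
  · intro x hx
    simp [hσ x (by simp [hx]), hFA x hx, hf x hx]
  · intro x hx
    simp [hσ x (by simp [hx]), hFB x hx, hg x hx]

open Classical in
lemma card_good_le {α : Type*} [Fintype α] [DecidableEq α] {m : ℕ} (e e' : α) (A B A' B' : Finset α)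
    (h1 : e ∉ A) (h2 : e ∉ B) (h3 : Disjoint A B)
    (h1' : e' ∉ A') (h2' : e' ∉ B') (h3' : Disjoint A' B')
    (hA : A.card = A'.card) (hB : B.card = B'.card) :
    (univ.filter (fun ω : Fin m ≃ α => goodOrd ω e' A' B')).card ≤
    (univ.filter (fun ω : Fin m ≃ α => goodOrd ω e A B)).card := by
  obtain ⟨σ, hσ, hσA, hσB⟩ := exists_perm e e' A B A' B' h1 h2 h3 h1' h2' h3' hA hB
  refine Finset.card_le_card_of_injOn (fun ω => ω.trans σ.symm) ?_ ?_
  · intro ω hω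
    have hω' := (Finset.mem_filter.1 (Finset.mem_coe.1 hω)).2
    refine Finset.mem_coe.2 (Finset.mem_filter.2 ⟨Finset.mem_univ _, fun x hx => ?_, fun x hx => ?_⟩)
    · simpa [hσ] using hω'.1 _ (hσA x hx)
    · simpa [hσ] using hω'.2 _ (hσB x hx)
  · intro ω _ ω' _ h
    ext i
    simpa using congrArg (fun t => t i) h

open Classical in
lemma unique_good {α : Type*} [Fintype α] [DecidableEq α] {m : ℕ} (ω : Fin m ≃ α) (T : Finset α) (a : ℕ)
    (ha : a < T.card) :
    ∃! p : (Σ _ : α, Finset α), p ∈ T.sigma (fun e => (T.erase e).powersetCard a) ∧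
      goodOrd ω p.1 p.2 ((T.erase p.1) \ p.2) := by
  let L : α → Finset α := fun e => T.filter (fun x => ω.symm x < ω.symm e)
  have hlt : ∀ x ∈ T, ∀ y ∈ T, ω.symm x < ω.symm y → (L x).card < (L y).card := by
    intro x hx y hy hxy
    apply Finset.card_lt_card
    rw [Finset.ssubset_iff_of_subset]
    · exact ⟨x, by simp [L, hx, hxy], by simp [L]⟩
    · intro z hz
      simp only [L, Finset.mem_filter] at hz ⊢
      exact ⟨hz.1, hz.2.trans hxy⟩
  have hinj : ∀ x ∈ T, ∀ y ∈ T, (L x).card = (L y).card → x = y := by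
    intro x hx y hy h
    rcases lt_trichotomy (ω.symm x) (ω.symm y) with h' | h' | h'
    · have := hlt x hx y hy h'; omega
    · exact ω.symm.injective h'
    · have := hlt y hy x hx h'; omega
  have himg : T.image (fun x => (L x).card) = Finset.range T.card := by
    apply Finset.eq_of_subset_of_card_le
    · intro k hk
      simp only [Finset.mem_image, Finset.mem_range] at hk ⊢
      obtain ⟨x, hx, rfl⟩ := hk
      apply Finset.card_lt_card
      rw [Finset.ssubset_iff_of_subset (Finset.filter_subset _ _)]
      exact ⟨x, hx, by simp⟩
    · rw [Finset.card_image_of_injOn (fun x hx y hy h => hinj x hx y hy h)]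
      simp
  have : a ∈ T.image (fun x => (L x).card) := by rw [himg]; simpa using ha
  obtain ⟨e, he, hea⟩ := Finset.mem_image.1 this
  refine ⟨⟨e, L e⟩, ⟨?_, ?_⟩, ?_⟩
  · simp only [Finset.mem_sigma, Finset.mem_powersetCard]
    refine ⟨he, ?_, hea⟩
    intro x hx
    simp only [L, Finset.mem_filter] at hx
    simp only [Finset.mem_erase]
    exact ⟨fun h => by simp [h] at hx, hx.1⟩
  · refine ⟨fun x hx => (Finset.mem_filter.1 hx).2, fun y hy => ?_⟩
    simp only [L, Finset.mem_sdiff, Finset.mem_erase, Finset.mem_filter, not_and, not_lt] at hy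
    exact lt_of_le_of_ne (hy.2 hy.1.2) (fun h => hy.1.1 (ω.symm.injective h.symm))
  · rintro ⟨e', A'⟩ ⟨hm, hg1, hg2⟩
    simp only [Finset.mem_sigma, Finset.mem_powersetCard] at hm hg1 hg2
    obtain ⟨he', hsub, hc⟩ := hm
    have hL : A' = L e' := by
      ext x
      simp only [L, Finset.mem_filter]
      constructor
      · intro hx
        exact ⟨Finset.mem_of_mem_erase (hsub hx), hg1 x hx⟩
      · rintro ⟨hx, hlt'⟩
        by_contra hxA
        have hne : x ≠ e' := fun h => by simp [h] at hlt'
        exact lt_asymm hlt' (hg2 x (by simp [hx, hxA, hne]))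
    subst hL
    have := hinj e' he' e he (by rw [hc]; exact hea.symm)
    subst this
    rfl

open Classical in
lemma card_good {α : Type*} [Fintype α] [DecidableEq α] {m : ℕ} (e : α) (A B : Finset α)
    (h1 : e ∉ A) (h2 : e ∉ B) (h3 : Disjoint A B) :
    (univ.filter (fun ω : Fin m ≃ α => goodOrd ω e A B)).card *
      ((A.card + 1) * (A.card + 1 + B.card).choose (A.card + 1)) = Fintype.card (Fin m ≃ α) := by
  set T := insert e (A ∪ B) with hT
  have hTc : T.card = A.card + B.card + 1 := by
    rw [hT, Finset.card_insert_of_notMem (by simp [h1, h2]), Finset.card_union_of_disjoint h3]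
  have key := Finset.sum_card_bipartiteAbove_eq_sum_card_bipartiteBelow
    (s := T.sigma (fun e => (T.erase e).powersetCard A.card))
    (t := (univ : Finset (Fin m ≃ α)))
    (fun p ω => goodOrd ω p.1 p.2 ((T.erase p.1) \ p.2))
  have hR : ∀ ω ∈ (univ : Finset (Fin m ≃ α)), ((T.sigma (fun e => (T.erase e).powersetCard A.card)).bipartiteBelow
    (fun p ω => goodOrd ω p.1 p.2 ((T.erase p.1) \ p.2)) ω).card = 1 := by
    intro ω _
    obtain ⟨p, hp, hu⟩ := unique_good ω T A.card (by omega)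
    rw [Finset.card_eq_one]
    refine ⟨p, ?_⟩
    ext q
    simp only [Finset.bipartiteBelow, Finset.mem_filter, Finset.mem_singleton]
    exact ⟨fun h => hu q h, fun h => h ▸ hp⟩
  have hLs : ∀ p ∈ T.sigma (fun e => (T.erase e).powersetCard A.card),
      ((univ : Finset (Fin m ≃ α)).bipartiteAbove
      (fun p ω => goodOrd ω p.1 p.2 ((T.erase p.1) \ p.2)) p).card =
      (univ.filter (fun ω : Fin m ≃ α => goodOrd ω e A B)).card := by
    rintro ⟨e', A'⟩ hp
    simp only [Finset.mem_sigma, Finset.mem_powersetCard] at hp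
    obtain ⟨he', hsub, hc⟩ := hp
    have c1 : e' ∉ A' := fun h => by simpa using hsub h
    have c2 : e' ∉ (T.erase e') \ A' := by simp
    have c3 : Disjoint A' ((T.erase e') \ A') := Finset.disjoint_sdiff
    have c4 : B.card = ((T.erase e') \ A').card := by
      rw [Finset.card_sdiff_of_subset hsub, Finset.card_erase_of_mem he']; omega
    apply le_antisymm
    · exact card_good_le e e' A B A' _ h1 h2 h3 c1 c2 c3 hc.symm c4
    · exact card_good_le e' e A' _ A B c1 c2 c3 h1 h2 h3 hc c4.symm
  rw [Finset.sum_congr rfl hLs, Finset.sum_congr rfl hR] at key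
  simp only [Finset.sum_const, Finset.card_sigma, smul_eq_mul, Finset.card_powersetCard, mul_one,
    Finset.card_univ] at key
  rw [Finset.sum_congr rfl (fun x hx => by rw [Finset.card_erase_of_mem hx, hTc, Nat.add_sub_cancel])] at key
  rw [Finset.sum_const, hTc, smul_eq_mul] at key
  rw [← key, mul_comm]
  congr 1
  have := Nat.add_one_mul_choose_eq (A.card + B.card) A.card
  rw [this, mul_comm, show A.card + 1 + B.card = A.card + B.card + 1 by ring]

lemma mem_prefixEdges {V : Type*} [DecidableEq V] {s : Finset (Sym2 V)}
    (ω : Fin s.card ≃ {e : Sym2 V // e ∈ s}) (i : ℕ) (x : {e : Sym2 V // e ∈ s}) :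
    x.1 ∈ prefixEdges ω i ↔ (ω.symm x : ℕ) < i := by
  simp only [prefixEdges, Finset.mem_image, Finset.mem_filter, Finset.mem_univ, true_and]
  constructor
  · rintro ⟨j, hj, h⟩
    have : ω j = x := Subtype.ext h
    rw [← this]; simpa using hj
  · intro h
    exact ⟨ω.symm x, h, by simp⟩

lemma one_le_degIn {V : Type*} [DecidableEq V] {s : Finset (Sym2 V)}
    (ω : Fin s.card ≃ {e : Sym2 V // e ∈ s}) (i : ℕ) (v : V) :
    1 ≤ degIn (prefixEdges ω i) v ↔ ∃ x : {e : Sym2 V // e ∈ s}, v ∈ x.1 ∧ (ω.symm x : ℕ) < i := by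
  rw [degIn, Nat.succ_le_iff, Finset.card_pos]
  constructor
  · rintro ⟨x, hx⟩
    obtain ⟨hx, hv⟩ := Finset.mem_filter.1 hx
    have hxs : x ∈ s := by
      obtain ⟨j, _, rfl⟩ := Finset.mem_image.1 hx
      exact (ω j).2
    exact ⟨⟨x, hxs⟩, hv, (mem_prefixEdges ω i ⟨x, hxs⟩).1 hx⟩
  · rintro ⟨x, hv, hx⟩
    exact ⟨x.1, Finset.mem_filter.2 ⟨(mem_prefixEdges ω i x).2 hx, hv⟩⟩

open Classical in
lemma subset_final_iff {V : Type*} [Fintype V] [DecidableEq V] {s : Finset (Sym2 V)}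
    (ω : Fin s.card ≃ {e : Sym2 V // e ∈ s}) (M : Finset {e : Sym2 V // e ∈ s})
    (hM : ∀ v, ∃ x ∈ M, v ∈ x.1) (hne : M.Nonempty) :
    (∀ x ∈ M, x.1 ∈ finalEdges 1 ω) ↔
      ∃ e ∈ M, ∃ v ∈ e.1, goodOrd ω e (M.erase e)
        ((univ.filter (fun x : {e : Sym2 V // e ∈ s} => v ∈ x.1)).erase e) := by
  simp only [finalEdges, mem_prefixEdges]
  set S : Set ℕ := {i | ∀ v : V, 1 ≤ degIn (prefixEdges ω i) v} with hS
  have hk : stopIndex 1 ω = sInf S := rfl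
  rw [hk]
  have hmem : ∀ i, i ∈ S ↔ ∀ v, ∃ x : {e : Sym2 V // e ∈ s}, v ∈ x.1 ∧ (ω.symm x : ℕ) < i :=
    fun i => forall_congr' fun v => one_le_degIn ω i v
  have hSne : S.Nonempty := by
    refine ⟨s.card, (hmem _).2 fun v => ?_⟩
    obtain ⟨x, _, hx⟩ := hM v
    exact ⟨x, hx, (ω.symm x).2⟩
  have hlt : ∀ i, i < sInf S ↔ i ∉ S := by
    intro i
    constructor
    · exact fun h => Nat.notMem_of_lt_sInf h
    · intro h
      by_contra hle
      apply h
      rw [hmem]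
      intro v
      obtain ⟨x, hx, hx'⟩ := (hmem _).1 (Nat.sInf_mem hSne) v
      exact ⟨x, hx, by omega⟩
  constructor
  · intro h
    obtain ⟨e, he, hmax⟩ := Finset.exists_max_image M (fun x => ω.symm x) hne
    have hA : ∀ x ∈ M.erase e, ω.symm x < ω.symm e := by
      intro x hx
      obtain ⟨hxe, hx⟩ := Finset.mem_erase.1 hx
      exact lt_of_le_of_ne (hmax x hx) (fun h => hxe (ω.symm.injective h))
    have h1 := (hlt _).1 (h e he)
    rw [hmem] at h1
    push Not at h1
    obtain ⟨v, hv⟩ := h1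
    refine ⟨e, he, v, ?_, hA, ?_⟩
    · obtain ⟨x, hx, hvx⟩ := hM v
      by_cases hxe : x = e
      · exact hxe ▸ hvx
      · have a1 := hv x hvx
        have a2 := hA x (Finset.mem_erase.2 ⟨hxe, hx⟩)
        rw [Fin.lt_def] at a2
        omega
    · intro y hy
      obtain ⟨hye, hy⟩ := Finset.mem_erase.1 hy
      have a1 := hv y (Finset.mem_filter.1 hy).2
      exact lt_of_le_of_ne (Fin.le_def.2 a1) (fun h => hye (ω.symm.injective h.symm))
  · rintro ⟨e, he, v, hv, h1, h2⟩
    have hek : (ω.symm e : ℕ) < sInf S := by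
      rw [hlt, hmem]
      push Not
      refine ⟨v, fun x hx => ?_⟩
      by_cases hxe : x = e
      · rw [hxe]
      · exact Fin.le_def.1 (h2 x (by simp [hxe, hx])).le
    intro x hx
    by_cases hxe : x = e
    · rw [hxe]; exact hek
    · exact (Fin.lt_def.1 (h1 x (by simp [hxe, hx]))).trans hek

open Classical in
lemma card_good_real {α : Type*} [Fintype α] [DecidableEq α] {m : ℕ} (e : α) (A B : Finset α)
    (h1 : e ∉ A) (h2 : e ∉ B) (h3 : Disjoint A B) (n b : ℕ) (hA : A.card + 1 = n) (hB : B.card = b) :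
    ((univ.filter (fun ω : Fin m ≃ α => goodOrd ω e A B)).card : ℝ) =
      Fintype.card (Fin m ≃ α) / (n * (n + b).choose n) := by
  have h := card_good (m := m) e A B h1 h2 h3
  rw [hA, hB] at h
  rw [← h]
  have hn : (n : ℝ) ≠ 0 := by exact_mod_cast (by omega : n ≠ 0)
  have hc : ((n + b).choose n : ℝ) ≠ 0 := by
    exact_mod_cast (Nat.choose_pos (by omega)).ne'
  push_cast
  field_simp

open Classical in
lemma card_edge {V : Type*} [Fintype V] [DecidableEq V] {s : Finset (Sym2 V)} (m n d : ℕ)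
    (M : Finset {e : Sym2 V // e ∈ s})
    (hM1 : ∀ v, ∀ x ∈ M, ∀ y ∈ M, v ∈ x.1 → v ∈ y.1 → x = y)
    (hMc : M.card = n)
    (hdiag : ∀ x ∈ s, ¬ x.IsDiag)
    (hd : ∀ v : V, (univ.filter (fun x : {e : Sym2 V // e ∈ s} => v ∈ x.1)).card = d)
    (e : {e : Sym2 V // e ∈ s}) (he : e ∈ M) :
    ((univ.filter (fun ω : Fin m ≃ {e : Sym2 V // e ∈ s} => ∃ v ∈ e.1, goodOrd ω e (M.erase e)
        ((univ.filter (fun x : {e : Sym2 V // e ∈ s} => v ∈ x.1)).erase e))).card : ℝ) =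
    (Fintype.card (Fin m ≃ {e : Sym2 V // e ∈ s}) : ℝ) / n *
      (2 / ((n + d - 1).choose n : ℝ) - 1 / ((n + 2 * d - 2).choose n : ℝ)) := by
  obtain ⟨u, v, huv⟩ : ∃ u v, e.1 = s(u, v) := by
    induction h : e.1 with | _ u v => exact ⟨u, v, rfl⟩
  have hne : u ≠ v := by
    have := hdiag e.1 e.2
    rw [huv] at this
    simpa using this
  set E : V → Finset {e : Sym2 V // e ∈ s} := fun v => (univ.filter (fun x : {e : Sym2 V // e ∈ s} => v ∈ x.1)).erase e with hE
  have hue : u ∈ e.1 := by simp [huv]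
  have hve : v ∈ e.1 := by simp [huv]
  have hEc : ∀ w ∈ e.1, (E w).card = d - 1 := by
    intro w hw
    rw [hE]
    dsimp only
    rw [Finset.card_erase_of_mem (by simp [hw]), hd]
  have hdpos : 1 ≤ d := by
    rw [← hd u]
    exact Finset.card_pos.2 ⟨e, by simp [hue]⟩
  have hdisj : Disjoint (E u) (E v) := by
    rw [Finset.disjoint_left]
    intro x hx hy
    simp only [hE, Finset.mem_erase, Finset.mem_filter, Finset.mem_univ, true_and] at hx hy
    apply hx.1
    apply Subtype.ext
    rw [huv]
    exact (Sym2.mem_and_mem_iff hne).1 ⟨hx.2, hy.2⟩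
  have hdM : ∀ w ∈ e.1, Disjoint (M.erase e) (E w) := by
    intro w hw
    rw [Finset.disjoint_left]
    intro x hx hy
    simp only [hE, Finset.mem_erase, Finset.mem_filter, Finset.mem_univ, true_and] at hx hy
    exact hx.1 (hM1 w x hx.2 e he hy.2 hw)
  have hnE : ∀ w, e ∉ E w := fun w => by simp [hE]
  have hMe : (M.erase e).card + 1 = n := by rw [Finset.card_erase_add_one he, hMc]
  have hnM : e ∉ M.erase e := by simp
  set SU := univ.filter (fun ω : Fin m ≃ {e : Sym2 V // e ∈ s} => goodOrd ω e (M.erase e) (E u)) with hSU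
  set SV := univ.filter (fun ω : Fin m ≃ {e : Sym2 V // e ∈ s} => goodOrd ω e (M.erase e) (E v)) with hSV
  have hU : (univ.filter (fun ω : Fin m ≃ {e : Sym2 V // e ∈ s} => ∃ v ∈ e.1, goodOrd ω e (M.erase e)
        (E v))) = SU ∪ SV := by
    ext ω
    simp only [hSU, hSV, Finset.mem_filter, Finset.mem_union, Finset.mem_univ, true_and, huv, Sym2.mem_iff]
    constructor
    · rintro ⟨w, rfl | rfl, h⟩
      · exact Or.inl h
      · exact Or.inr h
    · rintro (h | h)
      · exact ⟨u, Or.inl rfl, h⟩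
      · exact ⟨v, Or.inr rfl, h⟩
  have hI : SU ∩ SV = univ.filter (fun ω : Fin m ≃ {e : Sym2 V // e ∈ s} => goodOrd ω e (M.erase e) (E u ∪ E v)) := by
    ext ω
    simp only [hSU, hSV, Finset.mem_filter, Finset.mem_inter, Finset.mem_univ, true_and]
    constructor
    · rintro ⟨h, h'⟩
      refine ⟨h.1, fun y hy => ?_⟩
      rcases Finset.mem_union.1 hy with hy | hy
      · exact h.2 y hy
      · exact h'.2 y hy
    · intro h
      exact ⟨⟨h.1, fun y hy => h.2 y (Finset.mem_union_left _ hy)⟩,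
        ⟨h.1, fun y hy => h.2 y (Finset.mem_union_right _ hy)⟩⟩
  have key : ((SU ∪ SV).card : ℝ) + ((SU ∩ SV).card : ℝ) = SU.card + SV.card := by
    exact_mod_cast Finset.card_union_add_card_inter SU SV
  rw [hU]
  rw [hI, hSU, hSV,
    card_good_real e _ _ hnM (hnE u) (hdM u hue) n (d - 1) hMe (hEc u hue),
    card_good_real e _ _ hnM (hnE v) (hdM v hve) n (d - 1) hMe (hEc v hve),
    card_good_real e _ _ hnM (by simp [hnE]) (Finset.disjoint_union_right.2 ⟨hdM u hue, hdM v hve⟩) n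
      (2 * d - 2) hMe (by rw [Finset.card_union_of_disjoint hdisj, hEc u hue, hEc v hve]; omega)] at key
  rw [← hSU, ← hSV] at key
  rw [show n + d - 1 = n + (d - 1) by omega, show n + 2 * d - 2 = n + (2 * d - 2) by omega]
  rw [eq_sub_of_add_eq key]
  have hn : (n : ℝ) ≠ 0 := by exact_mod_cast (by omega : n ≠ 0)
  have hc1 : ((n + (d - 1)).choose n : ℝ) ≠ 0 := by
    exact_mod_cast (Nat.choose_pos (by omega)).ne'
  have hc2 : ((n + (2 * d - 2)).choose n : ℝ) ≠ 0 := by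
    exact_mod_cast (Nat.choose_pos (by omega)).ne'
  field_simp
  ring

open Classical in
lemma card_matching {V : Type*} [Fintype V] [DecidableEq V] {s : Finset (Sym2 V)} (n d : ℕ)
    (hn : 0 < n)
    (M : Finset {e : Sym2 V // e ∈ s})
    (hM : ∀ v, ∃ x ∈ M, v ∈ x.1)
    (hM1 : ∀ v, ∀ x ∈ M, ∀ y ∈ M, v ∈ x.1 → v ∈ y.1 → x = y)
    (hMc : M.card = n)
    (hdiag : ∀ x ∈ s, ¬ x.IsDiag)
    (hd : ∀ v : V, (univ.filter (fun x : {e : Sym2 V // e ∈ s} => v ∈ x.1)).card = d) :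
    ((univ.filter (fun ω : Fin s.card ≃ {e : Sym2 V // e ∈ s} =>
      ∀ x ∈ M, x.1 ∈ finalEdges 1 ω)).card : ℝ) =
    (Fintype.card (Fin s.card ≃ {e : Sym2 V // e ∈ s}) : ℝ) *
      (2 / ((n + d - 1).choose n : ℝ) - 1 / ((n + 2 * d - 2).choose n : ℝ)) := by
  have hne : M.Nonempty := Finset.card_pos.1 (by omega)
  have hU : (univ.filter (fun ω : Fin s.card ≃ {e : Sym2 V // e ∈ s} =>
      ∀ x ∈ M, x.1 ∈ finalEdges 1 ω)) = M.biUnion (fun e => univ.filter (fun ω : Fin s.card ≃ {e : Sym2 V // e ∈ s} => ∃ v ∈ e.1, goodOrd ω e (M.erase e)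
        ((univ.filter (fun x : {e : Sym2 V // e ∈ s} => v ∈ x.1)).erase e))) := by
    ext ω
    simp only [Finset.mem_filter, Finset.mem_univ, true_and, Finset.mem_biUnion]
    exact subset_final_iff ω M hM hne
  rw [hU, Finset.card_biUnion]
  · push_cast
    rw [Finset.sum_congr rfl (fun e he => card_edge s.card n d M hM1 hMc hdiag hd e he)]
    rw [Finset.sum_const, hMc, nsmul_eq_mul]
    have hn' : (n : ℝ) ≠ 0 := by exact_mod_cast hn.ne'
    field_simp
  · intro e he e' he' hee
    change Disjoint _ _
    rw [Finset.disjoint_left]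
    intro ω h h'
    obtain ⟨_, _, _, h, _⟩ := Finset.mem_filter.1 h
    obtain ⟨_, _, _, h', _⟩ := Finset.mem_filter.1 h'
    exact lt_asymm (h e' (Finset.mem_erase.2 ⟨hee.symm, he'⟩)) (h' e (Finset.mem_erase.2 ⟨hee, he⟩))

open Classical in
lemma card_J {V : Type*} [Fintype V] [DecidableEq V] (n d : ℕ) (hcard : Fintype.card V = 2 * n)
    (G : SimpleGraph V) [DecidableRel G.Adj] (hG : G.IsRegularOfDegree d)
    (J : SimpleGraph V) (hJ : J ≤ G) (hJ1 : regOfDegree J 1) :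
    ((univ.filter (fun ω : Fin G.edgeFinset.card ≃ {e : Sym2 V // e ∈ G.edgeFinset} =>
      J.edgeSet ⊆ ↑(finalEdges 1 ω))).card : ℝ) =
    (Fintype.card (Fin G.edgeFinset.card ≃ {e : Sym2 V // e ∈ G.edgeFinset}) : ℝ) *
      (2 / ((n + d - 1).choose n : ℝ) - 1 / ((n + 2 * d - 2).choose n : ℝ)) := by
  have hnb : ∀ v, ∃ w, J.neighborSet v = {w} := fun v => Set.ncard_eq_one.1 (hJ1 v)
  have hsub : ∀ x ∈ J.edgeSet, x ∈ G.edgeFinset := fun x hx => by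
    rw [SimpleGraph.mem_edgeFinset]; exact SimpleGraph.edgeSet_mono hJ hx
  rcases Nat.eq_zero_or_pos n with rfl | hn
  · have : IsEmpty V := Fintype.card_eq_zero_iff.1 (by simpa using hcard)
    have hall : ∀ ω : Fin G.edgeFinset.card ≃ {e : Sym2 V // e ∈ G.edgeFinset},
      J.edgeSet ⊆ ↑(finalEdges 1 ω) := by
      intro ω x
      induction x with | _ u v => exact this.elim u
    rw [Finset.filter_true_of_mem (fun ω _ => hall ω)]
    simp
    norm_num
  let M : Finset {e : Sym2 V // e ∈ G.edgeFinset} := univ.filter (fun x => x.1 ∈ J.edgeSet)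
  have hMm : ∀ x, x ∈ M ↔ x.1 ∈ J.edgeSet := fun x => by simp [M]
  have hMc : M.card = n := by
    have h1 : M.map (Function.Embedding.subtype _) = J.edgeFinset := by
      ext x
      simp only [Finset.mem_map, hMm, Function.Embedding.subtype_apply, SimpleGraph.mem_edgeFinset]
      constructor
      · rintro ⟨y, hy, rfl⟩; exact hy
      · intro hx; exact ⟨⟨x, hsub x hx⟩, hx, rfl⟩
    rw [← Finset.card_map, h1]
    have h2 := J.sum_degrees_eq_twice_card_edges
    have h3 : ∀ v, J.degree v = 1 := by
      intro v
      obtain ⟨w, hw⟩ := hnb v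
      rw [← SimpleGraph.card_neighborSet_eq_degree, ← Nat.card_eq_fintype_card, Nat.card_coe_set_eq]
      exact hJ1 v
    simp only [h3] at h2
    simp [hcard] at h2
    exact h2.symm
  have := card_matching (s := G.edgeFinset) n d hn M ?_ ?_ hMc ?_ ?_
  · rw [← this]
    congr 2
    ext ω
    simp only [Finset.mem_filter, Finset.mem_univ, true_and, hMm]
    constructor
    · intro h x hx
      exact h hx
    · intro h x hx
      exact h ⟨x, hsub x hx⟩ hx
  · intro v
    obtain ⟨w, hw⟩ := hnb v
    have hadj : J.Adj v w := by
      have : w ∈ J.neighborSet v := by rw [hw]; rfl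
      exact this
    exact ⟨⟨s(v, w), hsub _ hadj⟩, (hMm _).2 hadj, by simp⟩
  · intro v x hx y hy hvx hvy
    rw [hMm] at hx hy
    obtain ⟨w, hw⟩ := hnb v
    obtain ⟨x, hxs⟩ := x
    obtain ⟨y, hys⟩ := y
    obtain ⟨a, rfl⟩ := Sym2.mem_iff_exists.1 hvx
    obtain ⟨b, rfl⟩ := Sym2.mem_iff_exists.1 hvy
    have ha : a ∈ J.neighborSet v := hx
    have hb : b ∈ J.neighborSet v := hy
    rw [hw] at ha hb
    rw [Set.mem_singleton_iff] at ha hb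
    subst ha; subst hb; rfl
  · intro x hx
    exact G.not_isDiag_of_mem_edgeSet (SimpleGraph.mem_edgeFinset.1 hx)
  · intro v
    rw [← hG v, ← SimpleGraph.card_incidenceFinset_eq_degree, ← Finset.card_map (Function.Embedding.subtype _)]
    congr 1
    ext x
    simp only [Finset.mem_map, Finset.mem_filter, Finset.mem_univ, true_and, Function.Embedding.subtype_apply,
      SimpleGraph.mem_incidenceFinset]
    constructor
    · rintro ⟨y, hy, rfl⟩
      exact ⟨SimpleGraph.mem_edgeFinset.1 y.2, hy⟩
    · rintro ⟨h1, h2⟩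
      exact ⟨⟨x, SimpleGraph.mem_edgeFinset.2 h1⟩, h2, rfl⟩

/-- Let `G` be a `d`-regular finite simple graph on `2n` vertices containing at least one
perfect matching (1-regular spanning subgraph).  Form `G_ω` by listing the edges of `G` in
a uniformly random order and stopping as soon as every vertex has degree at least `1`.
Then the expected fraction of the perfect matchings of `G` contained in `G_ω` equals
`2/C(n+d−1,n) − 1/C(n+2d−2,n)`. -/
theorem expected_fraction_of_matchings_regular
    {V : Type*} [Fintype V] [DecidableEq V] (n d : ℕ) (hcard : Fintype.card V = 2 * n)
    (G : SimpleGraph V) [DecidableRel G.Adj] (hG : G.IsRegularOfDegree d)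
    (hex : ∃ J : SimpleGraph V, J ≤ G ∧ regOfDegree J 1) :
    (∑ ω : Fin G.edgeFinset.card ≃ {e : Sym2 V // e ∈ G.edgeFinset},
        (({J : SimpleGraph V | J ≤ G ∧ regOfDegree J 1 ∧
              J.edgeSet ⊆ ↑(finalEdges 1 ω)}.ncard : ℝ) /
          ({J : SimpleGraph V | J ≤ G ∧ regOfDegree J 1}.ncard : ℝ))) /
      (Fintype.card (Fin G.edgeFinset.card ≃ {e : Sym2 V // e ∈ G.edgeFinset}) : ℝ) =
    2 / ((n + d - 1).choose n : ℝ) - 1 / ((n + 2 * d - 2).choose n : ℝ) := by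
  classical
  set P : Finset (SimpleGraph V) := univ.filter (fun J => J ≤ G ∧ regOfDegree J 1) with hP
  have hK : {J : SimpleGraph V | J ≤ G ∧ regOfDegree J 1}.ncard = P.card := by
    rw [← Set.ncard_coe_finset]
    congr 1
    ext J
    simp [hP]
  have hKω : ∀ ω : Fin G.edgeFinset.card ≃ {e : Sym2 V // e ∈ G.edgeFinset},
      {J : SimpleGraph V | J ≤ G ∧ regOfDegree J 1 ∧ J.edgeSet ⊆ ↑(finalEdges 1 ω)}.ncard =
      (P.filter (fun J => J.edgeSet ⊆ ↑(finalEdges 1 ω))).card := by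
    intro ω
    rw [← Set.ncard_coe_finset]
    congr 1
    ext J
    simp [hP, and_assoc]
  have hpos : 0 < P.card := by
    obtain ⟨J, hJ⟩ := hex
    exact Finset.card_pos.2 ⟨J, by simpa [hP] using hJ⟩
  rw [hK]
  simp only [hKω]
  rw [← Finset.sum_div]
  have hdc : (∑ ω : Fin G.edgeFinset.card ≃ {e : Sym2 V // e ∈ G.edgeFinset},
      ((P.filter (fun J => J.edgeSet ⊆ ↑(finalEdges 1 ω))).card : ℝ)) =
      ∑ J ∈ P, ((univ.filter (fun ω : Fin G.edgeFinset.card ≃ {e : Sym2 V // e ∈ G.edgeFinset} =>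
        J.edgeSet ⊆ ↑(finalEdges 1 ω))).card : ℝ) := by
    have := Finset.sum_card_bipartiteAbove_eq_sum_card_bipartiteBelow (s := P)
      (t := (univ : Finset (Fin G.edgeFinset.card ≃ {e : Sym2 V // e ∈ G.edgeFinset})))
      (fun J ω => J.edgeSet ⊆ ↑(finalEdges 1 ω))
    exact_mod_cast this.symm
  rw [hdc, Finset.sum_congr rfl (fun J hJ => card_J n d hcard G hG J
    (Finset.mem_filter.1 hJ).2.1 (Finset.mem_filter.1 hJ).2.2)]
  rw [Finset.sum_const, nsmul_eq_mul]
  have hP0 : (P.card : ℝ) ≠ 0 := by exact_mod_cast hpos.ne'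
  have hN0 : (Fintype.card (Fin G.edgeFinset.card ≃ {e : Sym2 V // e ∈ G.edgeFinset}) : ℝ) ≠ 0 := by
    have : Nonempty (Fin G.edgeFinset.card ≃ {e : Sym2 V // e ∈ G.edgeFinset}) :=
      ⟨G.edgeFinset.equivFin.symm⟩
    exact_mod_cast Fintype.card_ne_zero
  rw [mul_div_assoc, mul_div_assoc, mul_comm, mul_div_assoc, mul_comm]
  generalize (2 / ((n + d - 1).choose n : ℝ) - 1 / ((n + 2 * d - 2).choose n : ℝ)) = R
  field_simp
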